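/- Let q be a complex number with q ≠ 0 and q^j ≠ 1 for all 1 ≤ j ≤ m+n, where m, n ≥ 0 are integers. Then ∑_{k=1}^{n} (−1)^k · q^{m·k + k(k+1)/2} / ( (q;q)_k · (q;q)_{n-k} · (q^k;q)_{m+1} ) − ∑_{k=1}^{m} (−1)^k · q^{n·k + k(k+1)/2} / ( (q;q)_k · (q;q)_{m-k} · (q^k;q)_{n+1} ) = ( ∑_{k=1}^{m} q^k/(1−q^k) − ∑_{k=1}^{n} q^k/(1−q^k) ) / ( (q;q)_m · (q;q)_n ). -/

import Mathlib

open Finset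

/-- The q-Pochhammer symbol `(x;q)_N = ∏_{j=0}^{N-1} (1 - x q^j)`. -/
noncomputable def qPoch (q x : ℂ) (N : ℕ) : ℂ := ∏ j ∈ Finset.range N, (1 - x * q ^ j)

theorem qPoch_self_succ (q : ℂ) (N : ℕ) :
    qPoch q q (N + 1) = qPoch q q N * (1 - q ^ (N + 1)) := by
  simp [qPoch, prod_range_succ, pow_succ']

theorem qPoch_self_mul_qPoch_pow (q : ℂ) (k N : ℕ) :
    qPoch q q k * qPoch q (q ^ (k + 1)) N = qPoch q q (k + N) := by
  simp only [qPoch, prod_range_add]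
  congr 1
  refine prod_congr rfl fun j _ => ?_
  ring

theorem one_sub_pow_ne_zero {q : ℂ} {N : ℕ} (h : ∀ j : ℕ, 1 ≤ j → j ≤ N → q ^ j ≠ 1)
    {j : ℕ} (hj : 1 ≤ j) (hjN : j ≤ N) : 1 - q ^ j ≠ 0 :=
  sub_ne_zero.2 (h j hj hjN).symm

theorem qPoch_self_ne_zero {q : ℂ} {N : ℕ} (h : ∀ j : ℕ, 1 ≤ j → j ≤ N → q ^ j ≠ 1)
    {k : ℕ} (hk : k ≤ N) : qPoch q q k ≠ 0 := by
  refine prod_ne_zero_iff.2 fun j hj => ?_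
  rw [← pow_succ']
  have := mem_range.1 hj
  exact one_sub_pow_ne_zero h (by omega) (by omega)

theorem succ_mul_succ_succ_div_two (i : ℕ) :
    (i + 1) * (i + 1 + 1) / 2 = i * (i + 1) / 2 + (i + 1) := by
  rw [show (i + 1) * (i + 1 + 1) = i * (i + 1) + (i + 1) * 2 by ring,
    Nat.add_mul_div_right _ _ two_pos]

/-- One half of the alternating sum, with all Pochhammer symbols based at `q`. -/
noncomputable def halfSum (q : ℂ) (m n : ℕ) : ℂ :=
  ∑ i ∈ range n, (-1 : ℂ) ^ (i + 1) * q ^ (m * (i + 1) + (i + 1) * (i + 1 + 1) / 2)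
    / ((1 - q ^ (i + 1)) * qPoch q q (n - (i + 1)) * qPoch q q (m + (i + 1)))

/-- A truncated alternating `q`-binomial sum. -/
noncomputable def truncSum (q : ℂ) (m n : ℕ) : ℂ :=
  ∑ i ∈ range n, (-1 : ℂ) ^ (i + 1) * q ^ (m * (i + 1) + i * (i + 1) / 2)
    / (qPoch q q (n - (i + 1)) * qPoch q q (m + (i + 1)))

theorem sum_Icc_eq_halfSum (q : ℂ) (m n : ℕ) :
    (∑ k ∈ Icc 1 n, (-1 : ℂ) ^ k * q ^ (m * k + k * (k + 1) / 2)
      / (qPoch q q k * qPoch q q (n - k) * qPoch q (q ^ k) (m + 1))) = halfSum q m n := by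
  rw [← Ico_add_one_right_eq_Icc, sum_Ico_eq_sum_range, halfSum, Nat.add_sub_cancel]
  refine sum_congr rfl fun i _ => ?_
  rw [add_comm 1 i, show m + (i + 1) = i + (m + 1) by ring, ← qPoch_self_mul_qPoch_pow q i (m + 1),
    qPoch_self_succ]
  congr 1
  ring

theorem truncSum_partial {q : ℂ} {m n : ℕ} (h : ∀ j : ℕ, 1 ≤ j → j ≤ m + n → q ^ j ≠ 1)
    {r : ℕ} (hr : r ≤ n) :
    (1 - q ^ (m + n)) * ∑ i ∈ range r, (-1 : ℂ) ^ (i + 1) * q ^ (m * (i + 1) + i * (i + 1) / 2)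
        / (qPoch q q (n - (i + 1)) * qPoch q q (m + (i + 1)))
      = (-1) ^ r * q ^ (m * (r + 1) + r * (r + 1) / 2) * (1 - q ^ (n - r))
          / (qPoch q q (n - r) * qPoch q q (m + r))
        - q ^ m * (1 - q ^ n) / (qPoch q q n * qPoch q q m) := by
  induction r with
  | zero => simp
  | succ r ih =>
    rw [sum_range_succ, mul_add, ih (by omega), succ_mul_succ_succ_div_two]
    obtain ⟨s, rfl⟩ := Nat.exists_eq_add_of_le hr
    rw [show r + 1 + s - (r + 1) = s by omega, show r + 1 + s - r = s + 1 by omega,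
      ← add_assoc m r 1, qPoch_self_succ, qPoch_self_succ]
    have h1 := qPoch_self_ne_zero h (k := s) (by omega)
    have h2 := qPoch_self_ne_zero h (k := m + r) (by omega)
    have h3 := one_sub_pow_ne_zero h (j := s + 1) (by omega) (by omega)
    have h4 := one_sub_pow_ne_zero h (j := m + r + 1) (by omega) (by omega)
    rw [sub_add_eq_add_sub]
    congr 1
    generalize r * (r + 1) / 2 = t
    field_simp
    ring

theorem truncSum_eq {q : ℂ} {m n : ℕ} (h : ∀ j : ℕ, 1 ≤ j → j ≤ m + n → q ^ j ≠ 1) :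
    (1 - q ^ (m + n)) * truncSum q m n
      = -(q ^ m * (1 - q ^ n) / (qPoch q q n * qPoch q q m)) := by
  rw [truncSum, truncSum_partial h le_rfl]
  simp

theorem halfSum_succ_right {q : ℂ} {m n : ℕ}
    (h : ∀ j : ℕ, 1 ≤ j → j ≤ m + (n + 1) → q ^ j ≠ 1) :
    (1 - q ^ (n + 1)) * halfSum q m (n + 1) - halfSum q m n
      = q ^ (n + 1) * truncSum q m (n + 1) := by
  simp only [halfSum, truncSum, sum_range_succ _ n]
  rw [mul_add (1 - q ^ (n + 1)), mul_add (q ^ (n + 1)), add_sub_right_comm, mul_sum, mul_sum, ← sum_sub_distrib]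
  congr 1
  · refine sum_congr rfl fun i hi => ?_
    obtain ⟨s, rfl⟩ := Nat.exists_eq_add_of_lt (mem_range.1 hi)
    rw [succ_mul_succ_succ_div_two, show i + s + 1 + 1 - (i + 1) = s + 1 by omega,
      show i + s + 1 - (i + 1) = s by omega, qPoch_self_succ]
    have h1 := qPoch_self_ne_zero h (k := s) (by omega)
    have h2 := qPoch_self_ne_zero h (k := m + (i + 1)) (by omega)
    have h3 := one_sub_pow_ne_zero h (j := s + 1) (by omega) (by omega)
    have h4 := one_sub_pow_ne_zero h (j := i + 1) (by omega) (by omega)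
    generalize i * (i + 1) / 2 = t
    field_simp
    ring
  · rw [succ_mul_succ_succ_div_two]
    have h2 := qPoch_self_ne_zero h (k := m + (n + 1)) (by omega)
    have h4 := one_sub_pow_ne_zero h (j := n + 1) (by omega) (by omega)
    have h5 := qPoch_self_ne_zero h (k := n + 1 - (n + 1)) (by omega)
    generalize n * (n + 1) / 2 = t
    field_simp
    ring

theorem halfSum_succ_left {q : ℂ} {m n : ℕ}
    (h : ∀ j : ℕ, 1 ≤ j → j ≤ m + (n + 1) → q ^ j ≠ 1) :
    (1 - q ^ (n + 1)) * halfSum q (n + 1) m - halfSum q n m = -truncSum q (n + 1) m := by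
  simp only [halfSum, truncSum]
  rw [mul_sum, ← sum_sub_distrib, ← sum_neg_distrib]
  refine sum_congr rfl fun i hi => ?_
  have := mem_range.1 hi
  rw [succ_mul_succ_succ_div_two, show n + 1 + (i + 1) = n + (i + 1) + 1 by ring,
    qPoch_self_succ]
  have h1 := qPoch_self_ne_zero h (k := m - (i + 1)) (by omega)
  have h2 := qPoch_self_ne_zero h (k := n + (i + 1)) (by omega)
  have h3 := one_sub_pow_ne_zero h (j := n + (i + 1) + 1) (by omega) (by omega)
  have h4 := one_sub_pow_ne_zero h (j := i + 1) (by omega) (by omega)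
  generalize i * (i + 1) / 2 = t
  field_simp
  ring

theorem halfSum_sub_halfSum_succ {q : ℂ} {m n : ℕ}
    (h : ∀ j : ℕ, 1 ≤ j → j ≤ m + (n + 1) → q ^ j ≠ 1) :
    (1 - q ^ (n + 1)) * (halfSum q m (n + 1) - halfSum q (n + 1) m)
      = halfSum q m n - halfSum q n m - q ^ (n + 1) / (qPoch q q m * qPoch q q (n + 1)) := by
  have hN := one_sub_pow_ne_zero h (j := m + (n + 1)) (by omega) le_rfl
  have e1 := truncSum_eq h
  have e2 := truncSum_eq (q := q) (m := n + 1) (n := m) (by rwa [add_comm])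
  rw [add_comm (n + 1) m] at e2
  have key : q ^ (n + 1) * truncSum q m (n + 1) + truncSum q (n + 1) m
      = -(q ^ (n + 1) / (qPoch q q m * qPoch q q (n + 1))) := by
    refine mul_left_cancel₀ hN ?_
    rw [mul_add, mul_left_comm, e1, e2, pow_add q m]
    ring
  linear_combination halfSum_succ_right h - halfSum_succ_left h + key

theorem halfSum_sub_halfSum_of_zero {q : ℂ} {m : ℕ} {c : ℂ}
    (h0 : halfSum q m 0 - halfSum q 0 m = c / qPoch q q m) (n : ℕ)
    (h : ∀ j : ℕ, 1 ≤ j → j ≤ m + n → q ^ j ≠ 1) :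
    halfSum q m n - halfSum q n m
      = (c - ∑ k ∈ Icc 1 n, q ^ k / (1 - q ^ k)) / (qPoch q q m * qPoch q q n) := by
  induction n with
  | zero => simpa [qPoch] using h0
  | succ n ih =>
    have h1 := qPoch_self_ne_zero h (k := m) (by omega)
    have h2 := qPoch_self_ne_zero h (k := n) (by omega)
    have h3 := one_sub_pow_ne_zero h (j := n + 1) (by omega) (by omega)
    refine mul_left_cancel₀ h3 ?_
    rw [halfSum_sub_halfSum_succ h, ih fun j hj hj' => h j hj (by omega),
      sum_Icc_succ_top (by omega), qPoch_self_succ]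
    field_simp
    ring

theorem stmt_19 (q : ℂ) (hq : q ≠ 0) (m n : ℕ)
    (hq1 : ∀ j : ℕ, 1 ≤ j → j ≤ m + n → q ^ j ≠ 1) :
    (∑ k ∈ Finset.Icc 1 n,
        (-1 : ℂ) ^ k * q ^ (m * k + k * (k + 1) / 2)
          / (qPoch q q k * qPoch q q (n - k) * qPoch q (q ^ k) (m + 1)))
      - (∑ k ∈ Finset.Icc 1 m,
          (-1 : ℂ) ^ k * q ^ (n * k + k * (k + 1) / 2)
            / (qPoch q q k * qPoch q q (m - k) * qPoch q (q ^ k) (n + 1)))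
      = ((∑ k ∈ Finset.Icc 1 m, q ^ k / (1 - q ^ k))
          - ∑ k ∈ Finset.Icc 1 n, q ^ k / (1 - q ^ k))
          / (qPoch q q m * qPoch q q n) := by
  rw [sum_Icc_eq_halfSum, sum_Icc_eq_halfSum]
  refine halfSum_sub_halfSum_of_zero ?_ n hq1
  have h := halfSum_sub_halfSum_of_zero (q := q) (m := 0) (c := 0) (by simp [halfSum]) m
    fun j hj hj' => hq1 j hj (by omega)
  rw [← neg_sub, h]
  simp [qPoch, neg_div]
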